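/- (Ertel's theorem) Let u, ρ, S, T be smooth fields on ℝ × ℝ³ with ρ > 0 everywhere, and set ω = ∇×u. Assume the vorticity equation ∂ω/∂t − ∇×(u×ω) = ∇T × ∇S, the mass continuity equation ∂ρ/∂t + ∇·(ρu) = 0, and the entropy advection equation ∂S/∂t + u·∇S = 0. Then the potential vorticity q = (ω·∇S)/ρ is advected with the flow: (∂/∂t + u·∇)( (ω·∇S)/ρ ) = 0. -/

import Mathlib

noncomputable section

/-- Vectors in ℝ³. -/
abbrev Vec3 : Type := Fin 3 → ℝ

/-- Points of space-time: `(t, x)` with `t : ℝ`, `x : Fin 3 → ℝ`. -/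
abbrev Pt : Type := ℝ × Vec3

/-- Euclidean dot product on ℝ³. -/
def dot3 (a b : Vec3) : ℝ := ∑ i, a i * b i

/-- Cross product on ℝ³. -/
def cross3 (a b : Vec3) : Vec3 :=
  ![a 1 * b 2 - a 2 * b 1, a 2 * b 0 - a 0 * b 2, a 0 * b 1 - a 1 * b 0]

/-- Spatial partial derivative ∂f/∂xᵢ of a scalar field. -/
def pd (i : Fin 3) (f : Pt → ℝ) (p : Pt) : ℝ :=
  fderiv ℝ (fun x => f (p.1, x)) p.2 (Pi.single i 1)

/-- Time derivative ∂f/∂t of a scalar field. -/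
def dt (f : Pt → ℝ) (p : Pt) : ℝ := deriv (fun s => f (s, p.2)) p.1

/-- Time derivative of a vector field, componentwise. -/
def dtVec (F : Pt → Vec3) (p : Pt) : Vec3 := fun i => dt (fun q => F q i) p

/-- Spatial gradient ∇f of a scalar field. -/
def grad3 (f : Pt → ℝ) (p : Pt) : Vec3 := fun i => pd i f p

/-- Spatial divergence ∇·F of a vector field. -/
def div3 (F : Pt → Vec3) (p : Pt) : ℝ := ∑ i, pd i (fun q => F q i) p

/-- Spatial curl ∇×F of a vector field. -/
def curl3 (F : Pt → Vec3) (p : Pt) : Vec3 :=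
  ![pd 1 (fun q => F q 2) p - pd 2 (fun q => F q 1) p,
    pd 2 (fun q => F q 0) p - pd 0 (fun q => F q 2) p,
    pd 0 (fun q => F q 1) p - pd 1 (fun q => F q 0) p]

/-- Directional derivative (u·∇)f of a scalar field. -/
def dirD (u : Pt → Vec3) (f : Pt → ℝ) (p : Pt) : ℝ := ∑ i, u p i * pd i f p

/-- Directional derivative (u·∇)F of a vector field. -/
def dirDVec (u F : Pt → Vec3) (p : Pt) : Vec3 :=
  fun j => ∑ i, u p i * pd i (fun q => F q j) p

/-- (∇u)ᵀ·A, the vector with i-th component ∑ⱼ (∂uʲ/∂xⁱ) Aⱼ. -/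
def gradTdot (u A : Pt → Vec3) (p : Pt) : Vec3 :=
  fun i => ∑ j, pd i (fun q => u q j) p * A p j

/-- A field is smooth when it is C^∞ jointly in time and space. -/
def SmoothS (f : Pt → ℝ) : Prop := ContDiff ℝ (⊤ : ℕ∞) f

/-- A vector field is smooth when it is C^∞ jointly in time and space. -/
def SmoothV (F : Pt → Vec3) : Prop := ContDiff ℝ (⊤ : ℕ∞) F

/-- Directional derivative in space-time. -/
def dd (v : Pt) (f : Pt → ℝ) (p : Pt) : ℝ := fderiv ℝ f p v

/-- Spatial basis direction in space-time. -/
def ev (i : Fin 3) : Pt := (0, Pi.single i 1)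

/-- Time direction in space-time. -/
def et : Pt := (1, 0)

theorem smooth_diffAt {f : Pt → ℝ} (hf : SmoothS f) (p : Pt) : DifferentiableAt ℝ f p :=
  (ContDiff.differentiable hf (by simp)) p

theorem pd_eq {f : Pt → ℝ} (hf : SmoothS f) (i : Fin 3) : pd i f = dd (ev i) f := by
  funext p
  have h1 : HasFDerivAt (fun x : Vec3 => ((p.1, x) : Pt)) (ContinuousLinearMap.inr ℝ ℝ Vec3) p.2 :=
    hasFDerivAt_prodMk_right p.1 p.2
  have h2 : HasFDerivAt f (fderiv ℝ f p) (p.1, p.2) := (smooth_diffAt hf p).hasFDerivAt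
  have h3 := h2.comp p.2 h1
  have h4 : fderiv ℝ (fun x => f (p.1, x)) p.2
      = (fderiv ℝ f p).comp (ContinuousLinearMap.inr ℝ ℝ Vec3) := h3.fderiv
  simp [pd, dd, ev, h4]

theorem dt_eq {f : Pt → ℝ} (hf : SmoothS f) : dt f = dd et f := by
  funext p
  have h1 : HasDerivAt (fun s : ℝ => ((s, p.2) : Pt)) ((1, 0) : Pt) p.1 :=
    (hasDerivAt_id p.1).prodMk (hasDerivAt_const p.1 p.2)
  have h2 : HasFDerivAt f (fderiv ℝ f p) (p.1, p.2) := (smooth_diffAt hf p).hasFDerivAt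
  have h3 := h2.comp_hasDerivAt p.1 h1
  exact h3.deriv

theorem dd_smooth {f : Pt → ℝ} (hf : SmoothS f) (v : Pt) : SmoothS (dd v f) := by
  have h : ContDiff ℝ (⊤ : ℕ∞) (fderiv ℝ f) := ContDiff.fderiv_right hf (by simp)
  exact h.clm_apply contDiff_const

theorem dd_comm {f : Pt → ℝ} (hf : SmoothS f) (v w : Pt) (p : Pt) :
    dd v (dd w f) p = dd w (dd v f) p := by
  have h : ContDiff ℝ (⊤ : ℕ∞) (fderiv ℝ f) := ContDiff.fderiv_right hf (by simp)
  have hd : DifferentiableAt ℝ (fderiv ℝ f) p := (h.differentiable (by simp)) p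
  have key : ∀ a b : Pt, dd a (dd b f) p = fderiv ℝ (fderiv ℝ f) p a b := by
    intro a b
    have := (hd.hasFDerivAt.clm_apply (hasFDerivAt_const b p)).fderiv
    change fderiv ℝ (fun q => fderiv ℝ f q b) p a = _
    rw [this]
    simp
  rw [key, key]
  have hs : IsSymmSndFDerivAt ℝ f p :=
    (ContDiff.contDiffAt hf).isSymmSndFDerivAt (by
      rw [minSmoothness_of_isRCLikeNormedField]; exact WithTop.coe_le_coe.2 le_top)
  exact hs.eq v w

theorem smooth_add {f g : Pt → ℝ} (hf : SmoothS f) (hg : SmoothS g) :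
    SmoothS (fun q => f q + g q) := ContDiff.add hf hg

theorem smooth_sub {f g : Pt → ℝ} (hf : SmoothS f) (hg : SmoothS g) :
    SmoothS (fun q => f q - g q) := ContDiff.sub hf hg

theorem smooth_mul {f g : Pt → ℝ} (hf : SmoothS f) (hg : SmoothS g) :
    SmoothS (fun q => f q * g q) := ContDiff.mul hf hg

theorem dd_add {f g : Pt → ℝ} (hf : SmoothS f) (hg : SmoothS g) (v p : Pt) :
    dd v (fun q => f q + g q) p = dd v f p + dd v g p := by
  have := ((smooth_diffAt hf p).hasFDerivAt.add (smooth_diffAt hg p).hasFDerivAt).fderiv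
  change fderiv ℝ (f + g) p v = _
  rw [this]; rfl

theorem dd_sub {f g : Pt → ℝ} (hf : SmoothS f) (hg : SmoothS g) (v p : Pt) :
    dd v (fun q => f q - g q) p = dd v f p - dd v g p := by
  have := ((smooth_diffAt hf p).hasFDerivAt.sub (smooth_diffAt hg p).hasFDerivAt).fderiv
  change fderiv ℝ (f - g) p v = _
  rw [this]; rfl

theorem dd_mul {f g : Pt → ℝ} (hf : SmoothS f) (hg : SmoothS g) (v p : Pt) :
    dd v (fun q => f q * g q) p = f p * dd v g p + g p * dd v f p := by
  have := ((smooth_diffAt hf p).hasFDerivAt.mul (smooth_diffAt hg p).hasFDerivAt).fderiv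
  change fderiv ℝ (f * g) p v = _
  rw [this]; rfl

theorem smooth_inv {f : Pt → ℝ} (hf : SmoothS f) (h0 : ∀ p, 0 < f p) :
    SmoothS (fun q => (f q)⁻¹) := ContDiff.inv hf (fun p => (h0 p).ne')

theorem dd_inv {f : Pt → ℝ} (hf : SmoothS f) (h0 : ∀ p, 0 < f p) (v p : Pt) :
    dd v (fun q => (f q)⁻¹) p = - dd v f p / (f p) ^ 2 := by
  have h := dd_mul hf (smooth_inv hf h0) v p
  have e : (fun q => f q * (f q)⁻¹) = fun _ => (1 : ℝ) :=
    funext fun q => mul_inv_cancel₀ (h0 q).ne'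
  rw [e] at h
  have z : dd v (fun _ => (1 : ℝ)) p = 0 := by simp [dd]
  rw [z] at h
  have := (h0 p).ne'
  field_simp at h ⊢
  linarith

/-- Ertel's theorem: the potential vorticity q = (ω·∇S)/ρ is
    advected with the flow. -/
theorem ertel_theorem
    (u : Pt → Vec3) (ρ S T : Pt → ℝ)
    (hu : SmoothV u) (hρ : SmoothS ρ) (hS : SmoothS S) (hT : SmoothS T)
    (hρpos : ∀ p : Pt, 0 < ρ p)
    (hvort : ∀ p : Pt,
      dtVec (fun q => curl3 u q) p
        - curl3 (fun q => cross3 (u q) (curl3 u q)) p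
        = cross3 (grad3 T p) (grad3 S p))
    (hcont : ∀ p : Pt, dt ρ p + div3 (fun q => ρ q • u q) p = 0)
    (hent : ∀ p : Pt, dt S p + dirD u S p = 0) :
    ∀ p : Pt,
      dt (fun q => dot3 (curl3 u q) (grad3 S q) / ρ q) p
        + dirD u (fun q => dot3 (curl3 u q) (grad3 S q) / ρ q) p = 0 := by
  intro p
  have hU : ∀ j, SmoothS (fun q => u q j) := fun j => (contDiff_pi.1 hu) j
  obtain ⟨U, hUdef⟩ : ∃ U : Fin 3 → Pt → ℝ, U = fun j q => u q j := ⟨_, rfl⟩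
  have hus : ∀ j, SmoothS (U j) := by intro j; rw [hUdef]; exact hU j
  have hu' : ∀ j q, u q j = U j q := by intro j q; rw [hUdef]
  have hDU : ∀ v j, SmoothS (dd v (U j)) := fun v j => dd_smooth (hus j) v
  have hDS : ∀ v, SmoothS (dd v S) := fun v => dd_smooth hS v
  -- vorticity components
  obtain ⟨W, hWdef⟩ : ∃ W : Fin 3 → Pt → ℝ, W = fun j q => curl3 u q j := ⟨_, rfl⟩
  have hw' : ∀ j q, curl3 u q j = W j q := by intro j q; rw [hWdef]
  have hpu : ∀ i j, pd i (U j) = dd (ev i) (U j) := fun i j => pd_eq (hus j) i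
  have hW0 : W 0 = fun q => dd (ev 1) (U 2) q - dd (ev 2) (U 1) q := by
    funext q; rw [hWdef]; simp only [curl3, hu', ← hpu]; rfl
  have hW1 : W 1 = fun q => dd (ev 2) (U 0) q - dd (ev 0) (U 2) q := by
    funext q; rw [hWdef]; simp only [curl3, hu', ← hpu]; rfl
  have hW2 : W 2 = fun q => dd (ev 0) (U 1) q - dd (ev 1) (U 0) q := by
    funext q; rw [hWdef]; simp only [curl3, hu', ← hpu]; rfl
  have hws : ∀ j, SmoothS (W j) := by
    intro j
    fin_cases j
    · change SmoothS (W 0); rw [hW0]; exact smooth_sub (hDU _ _) (hDU _ _)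
    · change SmoothS (W 1); rw [hW1]; exact smooth_sub (hDU _ _) (hDU _ _)
    · change SmoothS (W 2); rw [hW2]; exact smooth_sub (hDU _ _) (hDU _ _)
  -- divergence of the vorticity vanishes
  have hdivW : dd (ev 0) (W 0) p + dd (ev 1) (W 1) p + dd (ev 2) (W 2) p = 0 := by
    rw [hW0, hW1, hW2]
    simp only [dd_sub (hDU _ _) (hDU _ _)]
    rw [dd_comm (hus 2) (ev 1) (ev 0), dd_comm (hus 1) (ev 2) (ev 0), dd_comm (hus 0) (ev 2) (ev 1)]
    ring
  -- curl of the cross product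
  have hcr : ∀ a b c d : Fin 3, ∀ i : Fin 3,
      pd i (fun q => U a q * W b q - U c q * W d q) p =
        (U a p * dd (ev i) (W b) p + W b p * dd (ev i) (U a) p)
        - (U c p * dd (ev i) (W d) p + W d p * dd (ev i) (U c) p) := by
    intro a b c d i
    rw [pd_eq (smooth_sub (smooth_mul (hus a) (hws b)) (smooth_mul (hus c) (hws d)))]
    rw [dd_sub (smooth_mul (hus a) (hws b)) (smooth_mul (hus c) (hws d)),
      dd_mul (hus a) (hws b), dd_mul (hus c) (hws d)]
  have hv := hvort p
  have hv0 := congrFun hv 0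
  have hv1 := congrFun hv 1
  have hv2 := congrFun hv 2
  clear hv
  simp only [dtVec, Pi.sub_apply, hw', dt_eq (hws _)] at hv0 hv1 hv2
  simp only [cross3, grad3, Matrix.cons_val_zero,
    Matrix.cons_val_one, Matrix.cons_val, hw', hu', pd_eq hS, pd_eq hT] at hv0 hv1 hv2
  simp only [curl3, Matrix.cons_val_zero, Matrix.cons_val_one, Matrix.cons_val, hcr] at hv0 hv1 hv2
  -- continuity
  have hc := hcont p
  have hru : ∀ i j, pd i (fun q => ρ q * U j q) p
      = ρ p * dd (ev i) (U j) p + U j p * dd (ev i) ρ p := by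
    intro i j
    rw [pd_eq (smooth_mul hρ (hus j)), dd_mul hρ (hus j)]
  simp only [div3, Pi.smul_apply, smul_eq_mul, hu', hru, Fin.sum_univ_three, dt_eq hρ] at hc
  -- entropy
  have hm : ∀ i, SmoothS (fun q => U i q * dd (ev i) S q) := fun i => smooth_mul (hus i) (hDS _)
  have he : ∀ v, dd v (dd et S) p
      + (U 0 p * dd v (dd (ev 0) S) p + dd (ev 0) S p * dd v (U 0) p
      + (U 1 p * dd v (dd (ev 1) S) p + dd (ev 1) S p * dd v (U 1) p)
      + (U 2 p * dd v (dd (ev 2) S) p + dd (ev 2) S p * dd v (U 2) p)) = 0 := by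
    intro v
    have e : (fun q => dd et S q + (U 0 q * dd (ev 0) S q + U 1 q * dd (ev 1) S q
        + U 2 q * dd (ev 2) S q)) = fun _ => (0 : ℝ) := by
      funext q
      have := hent q
      simpa only [dirD, dt_eq hS, pd_eq hS, hu', Fin.sum_univ_three] using this
    have z : dd v (fun _ => (0 : ℝ)) p = 0 := by simp [dd]
    rw [← e, dd_add (hDS et) (smooth_add (smooth_add (hm 0) (hm 1)) (hm 2)),
      dd_add (smooth_add (hm 0) (hm 1)) (hm 2), dd_add (hm 0) (hm 1),
      dd_mul (hus 0) (hDS _), dd_mul (hus 1) (hDS _), dd_mul (hus 2) (hDS _)] at z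
    exact z
  have he0 := he (ev 0)
  have he1 := he (ev 1)
  have he2 := he (ev 2)
  rw [dd_comm hS (ev 0) et] at he0
  rw [dd_comm hS (ev 1) et, dd_comm hS (ev 1) (ev 0)] at he1
  rw [dd_comm hS (ev 2) et, dd_comm hS (ev 2) (ev 0), dd_comm hS (ev 2) (ev 1)] at he2
  -- the potential vorticity
  have hn : ∀ i, SmoothS (fun q => W i q * dd (ev i) S q) := fun i => smooth_mul (hws i) (hDS _)
  have hns := smooth_add (smooth_add (hn 0) (hn 1)) (hn 2)
  have hqf : (fun q => dot3 (curl3 u q) (grad3 S q) / ρ q) =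
      fun q => (W 0 q * dd (ev 0) S q + W 1 q * dd (ev 1) S q + W 2 q * dd (ev 2) S q)
        * (ρ q)⁻¹ := by
    funext q
    simp only [dot3, grad3, Fin.sum_univ_three, hw', pd_eq hS, div_eq_mul_inv]
  have hqs := smooth_mul hns (smooth_inv hρ hρpos)
  have hq : ∀ v, dd v (fun q => (W 0 q * dd (ev 0) S q + W 1 q * dd (ev 1) S q
      + W 2 q * dd (ev 2) S q) * (ρ q)⁻¹) p =
      (W 0 p * dd (ev 0) S p + W 1 p * dd (ev 1) S p + W 2 p * dd (ev 2) S p)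
        * (- dd v ρ p / (ρ p) ^ 2)
      + (ρ p)⁻¹ * (W 0 p * dd v (dd (ev 0) S) p + dd (ev 0) S p * dd v (W 0) p
        + (W 1 p * dd v (dd (ev 1) S) p + dd (ev 1) S p * dd v (W 1) p)
        + (W 2 p * dd v (dd (ev 2) S) p + dd (ev 2) S p * dd v (W 2) p)) := by
    intro v
    rw [dd_mul hns (smooth_inv hρ hρpos), dd_inv hρ hρpos,
      dd_add (smooth_add (hn 0) (hn 1)) (hn 2), dd_add (hn 0) (hn 1),
      dd_mul (hws 0) (hDS _), dd_mul (hws 1) (hDS _), dd_mul (hws 2) (hDS _)]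
  rw [hqf, dirD, dt_eq hqs]
  simp only [pd_eq hqs, hq, Fin.sum_univ_three, hu']
  rw [dd_comm hS (ev 1) (ev 0), dd_comm hS (ev 2) (ev 0), dd_comm hS (ev 2) (ev 1)]
  have hr := (hρpos p).ne'
  field_simp
  linear_combination (ρ p) * (dd (ev 0) S p * hv0 + dd (ev 1) S p * hv1 + dd (ev 2) S p * hv2
    + W 0 p * he0 + W 1 p * he1 + W 2 p * he2)
    - (W 0 p * dd (ev 0) S p + W 1 p * dd (ev 1) S p + W 2 p * dd (ev 2) S p) * hc
    + (ρ p) * (U 0 p * dd (ev 0) S p + U 1 p * dd (ev 1) S p + U 2 p * dd (ev 2) S p) * hdivW
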